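/- arXiv:1307.7224 — 4 statements merged into one kernel-verified Lean document; each statement's English description precedes it below -/
import Mathlib

section
/- For a finite simple graph G and a field K, the toric ideal I_G is generated by the binomials B_w, where w ranges over the even closed walks of G; that is, I_G = ({B_w : w an even closed walk of G}). -/
open MvPolynomial

/-- The image of an edge `{i, j}` under the monomial map: the monomial `t_i * t_j`. -/
noncomputable def edgeMonomial (V K : Type) [CommRing K] : Sym2 V → MvPolynomial V K :=
  Sym2.lift ⟨fun i j => X i * X j, fun i j => mul_comm _ _⟩

/-- The toric ideal `I_G` of a graph `G`: the kernel of the `K`-algebra homomorphism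
from the polynomial ring with one variable per edge of `G` to the polynomial ring with
one variable per vertex, sending the variable of an edge `e = {v_i, v_j}` to `t_i t_j`. -/
noncomputable def toricIdeal (V K : Type) [Field K] (G : SimpleGraph V) :
    Ideal (MvPolynomial G.edgeSet K) :=
  RingHom.ker (aeval (fun e : G.edgeSet => edgeMonomial V K (e : Sym2 V)) :
    MvPolynomial G.edgeSet K →ₐ[K] MvPolynomial V K)

/-- The exponent vector of the monomial `t_i * t_j` attached to the edge `{i, j}`. -/
noncomputable def edgeExponent (V : Type) : Sym2 V → V →₀ ℕ :=
  Sym2.lift ⟨fun i j => Finsupp.single i 1 + Finsupp.single j 1, fun _ _ => add_comm _ _⟩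

theorem edgeExponent_mk {V : Type} (i j : V) :
    edgeExponent V s(i, j) = Finsupp.single i 1 + Finsupp.single j 1 := rfl

theorem mem_of_edgeExponent_ne_zero {V : Type} {z : Sym2 V} {v : V}
    (h : edgeExponent V z v ≠ 0) : v ∈ z := by
  classical
  induction z with
  | _ i j =>
    rw [edgeExponent_mk, Finsupp.add_apply, Finsupp.single_apply, Finsupp.single_apply] at h
    rw [Sym2.mem_iff]
    by_contra! hne
    simp [hne.1.symm, hne.2.symm] at h

theorem edgeMonomial_mk {V K : Type} [CommRing K] (i j : V) :
    edgeMonomial V K s(i, j) = X i * X j := rfl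

theorem edgeMonomial_eq_monomial {V K : Type} [CommRing K] (z : Sym2 V) :
    edgeMonomial V K z = monomial (edgeExponent V z) 1 := by
  induction z with
  | _ i j => simp [edgeMonomial_mk, edgeExponent_mk, X, monomial_mul]

/-- The vertex degrees of a multiset of edges. -/
noncomputable def vertexDegree {V : Type} (G : SimpleGraph V) :
    (G.edgeSet →₀ ℕ) →ₗ[ℕ] (V →₀ ℕ) :=
  Finsupp.linearCombination ℕ fun e : G.edgeSet => edgeExponent V (e : Sym2 V)

theorem vertexDegree_single {V : Type} {G : SimpleGraph V} (e : G.edgeSet) :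
    vertexDegree G (Finsupp.single e 1) = edgeExponent V (e : Sym2 V) := by
  simp [vertexDegree]

theorem aeval_edgeMonomial_monomial {V K : Type} [CommRing K] {G : SimpleGraph V}
    (m : G.edgeSet →₀ ℕ) (c : K) :
    aeval (fun e : G.edgeSet => edgeMonomial V K (e : Sym2 V)) (monomial m c) =
      monomial (vertexDegree G m) c := by
  simp only [aeval_monomial, edgeMonomial_eq_monomial, monomial_pow, one_pow, algebraMap_eq,
    vertexDegree, Finsupp.linearCombination_apply, Finsupp.prod, Finsupp.sum,
    ← monomial_sum_one, C_mul_monomial, mul_one]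

/-- An edge at a vertex of positive degree can be split off, exposing its other endpoint. -/
theorem exists_eq_add_single_of_vertexDegree_ne_zero {V : Type} {G : SimpleGraph V}
    {A : G.edgeSet →₀ ℕ} {v : V} (h : vertexDegree G A v ≠ 0) :
    ∃ (A' : G.edgeSet →₀ ℕ) (e : G.edgeSet) (a : V),
      A = A' + Finsupp.single e 1 ∧ (e : Sym2 V) = s(v, a) := by
  rw [vertexDegree, Finsupp.linearCombination_apply, Finsupp.sum, Finsupp.finsetSum_apply] at h
  obtain ⟨e, he, hne⟩ := Finset.exists_ne_zero_of_sum_ne_zero h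
  rw [Finsupp.smul_apply] at hne
  obtain ⟨a, ha⟩ := mem_of_edgeExponent_ne_zero (right_ne_zero_of_smul hne)
  refine ⟨A - Finsupp.single e 1, e, a, (tsub_add_cancel_of_le ?_).symm, ha⟩
  rw [Finsupp.single_le_iff]
  exact Nat.one_le_iff_ne_zero.2 (Finsupp.mem_support_iff.1 he)

theorem exists_vertexDegree_ne_zero {V : Type} {G : SimpleGraph V}
    {A : G.edgeSet →₀ ℕ} (h : A ≠ 0) : ∃ v, vertexDegree G A v ≠ 0 := by
  obtain ⟨⟨z, hz⟩, he⟩ := Finsupp.ne_iff.1 h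
  induction z with
  | _ i j =>
    refine ⟨i, fun h0 => ?_⟩
    have hle : Finsupp.single (⟨s(i, j), hz⟩ : G.edgeSet) 1 ≤ A := by
      rw [Finsupp.single_le_iff]
      exact Nat.one_le_iff_ne_zero.2 he
    rw [← tsub_add_cancel_of_le hle, map_add, vertexDegree_single, edgeExponent_mk] at h0
    simp at h0

/-- `P` and `Q` are the products of the odd and of the even edges of a walk of even length
from `u` to `v`. -/
def IsEvenWalkPair {V K : Type} [CommRing K] {G : SimpleGraph V} (u v : V)
    (P Q : MvPolynomial G.edgeSet K) : Prop :=
  ∃ (q : ℕ) (vert : ℕ → V) (e : ℕ → G.edgeSet),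
    (∀ j < 2 * q, (e j : Sym2 V) = s(vert j, vert (j + 1))) ∧
    vert 0 = u ∧ vert (2 * q) = v ∧
    P = (∏ k ∈ Finset.range q, X (e (2 * k))) ∧
    Q = ∏ k ∈ Finset.range q, X (e (2 * k + 1))

namespace IsEvenWalkPair

variable {V K : Type} [CommRing K] {G : SimpleGraph V}

theorem nil (e : G.edgeSet) (v : V) :
    IsEvenWalkPair v v (1 : MvPolynomial G.edgeSet K) 1 :=
  ⟨0, fun _ => v, fun _ => e, by simp⟩

theorem concat {u v a b : V} {P Q : MvPolynomial G.edgeSet K} (h : IsEvenWalkPair u v P Q)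
    {e f : G.edgeSet} (he : (e : Sym2 V) = s(v, a)) (hf : (f : Sym2 V) = s(a, b)) :
    IsEvenWalkPair u b (P * X e) (Q * X f) := by
  obtain ⟨q, vert, edge, hw, h0, hq, rfl, rfl⟩ := h
  refine ⟨q + 1, fun n => if n ≤ 2 * q then vert n else if n = 2 * q + 1 then a else b,
    fun n => if n < 2 * q then edge n else if n = 2 * q then e else f, ?_, ?_, ?_, ?_, ?_⟩
  · intro j hj
    rcases lt_trichotomy j (2 * q) with h | rfl | h
    · simp [h, h.le, Nat.succ_le_of_lt h, hw j h]
    · simp [he, hq]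
    · obtain rfl : j = 2 * q + 1 := by omega
      simp [hf]
  · simp [h0]
  · simp [mul_add]
  · rw [Finset.prod_range_succ]
    congr 1
    · refine Finset.prod_congr rfl fun k hk => ?_
      have hlt : 2 * k < 2 * q := by simpa using hk
      simp [hlt]
    · simp
  · rw [Finset.prod_range_succ]
    congr 1
    · refine Finset.prod_congr rfl fun k hk => ?_
      have hlt : 2 * k + 1 < 2 * q := by rw [Finset.mem_range] at hk; omega
      simp [hlt]
    · simp

theorem aeval_left_mul_X {u v : V} {P Q : MvPolynomial G.edgeSet K}
    (h : IsEvenWalkPair u v P Q) :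
    aeval (fun e : G.edgeSet => edgeMonomial V K (e : Sym2 V)) P * X v =
      aeval (fun e : G.edgeSet => edgeMonomial V K (e : Sym2 V)) Q * X u := by
  obtain ⟨q, vert, e, hw, rfl, rfl, rfl, rfl⟩ := h
  simp only [map_prod, aeval_X]
  induction q with
  | zero => simp
  | succ q ih =>
    have ih := ih fun j hj => hw j (by omega)
    rw [Finset.prod_range_succ, Finset.prod_range_succ, hw _ (by omega), hw _ (by omega),
      edgeMonomial_mk, edgeMonomial_mk, show 2 * (q + 1) = 2 * q + 1 + 1 by ring]
    linear_combination X (vert (2 * q + 1)) * X (vert (2 * q + 1 + 1)) * ih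

end IsEvenWalkPair

section Span

variable {V K : Type} [CommRing K] {G : SimpleGraph V} {J : Ideal (MvPolynomial G.edgeSet K)}

/-- Greedily extending an alternating walk closes it up, as long as vertex degrees match. -/
theorem IsEvenWalkPair.mul_monomial_sub_mem
    (hJ : ∀ v P Q, IsEvenWalkPair v v P Q → P - Q ∈ J) {u v : V}
    {P Q : MvPolynomial G.edgeSet K} (h : IsEvenWalkPair u v P Q) {A B : G.edgeSet →₀ ℕ}
    (hd : vertexDegree G A + Finsupp.single u 1 = vertexDegree G B + Finsupp.single v 1) :
    P * monomial A 1 - Q * monomial B 1 ∈ J := by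
  classical
  induction hn : A.degree generalizing u v P Q A B with
  | zero =>
    obtain rfl : A = 0 := (Finsupp.degree_eq_zero_iff A).1 hn
    have hB : B = 0 := by
      by_contra hB
      obtain ⟨w, hw⟩ := exists_vertexDegree_ne_zero hB
      have hdeg := congrArg Finsupp.degree hd
      simp only [map_add, map_zero, Finsupp.degree_single, zero_add] at hdeg
      have : vertexDegree G B = 0 := (Finsupp.degree_eq_zero_iff _).1 (by omega)
      simp [this] at hw
    subst hB
    have huv : u = v := by
      simpa [Finsupp.single_left_inj] using hd
    subst huv
    simpa using hJ _ _ _ h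
  | succ n ih =>
    have extend : ∀ {u v : V} {P Q : MvPolynomial G.edgeSet K}, IsEvenWalkPair u v P Q →
        vertexDegree G A + Finsupp.single u 1 = vertexDegree G B + Finsupp.single v 1 →
        vertexDegree G A v ≠ 0 → P * monomial A 1 - Q * monomial B 1 ∈ J := by
      intro u v P Q h hd hv
      obtain ⟨A', e, a, hA, he⟩ := exists_eq_add_single_of_vertexDegree_ne_zero hv
      have hd' : vertexDegree G A' + Finsupp.single a 1 + Finsupp.single u 1 =
          vertexDegree G B := by
        apply add_right_cancel (b := Finsupp.single v 1)
        rw [← hd, hA, map_add, vertexDegree_single, he, edgeExponent_mk]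
        abel
      have ha : vertexDegree G B a ≠ 0 := by simp [← hd']
      obtain ⟨B', f, b, hB, hf⟩ := exists_eq_add_single_of_vertexDegree_ne_zero ha
      have key := ih (h.concat he hf) (A := A') (B := B') ?_ ?_
      · convert key using 2
        · rw [hA, monomial_add_single]; ring
        · rw [hB, monomial_add_single]; ring
      · apply add_right_cancel (b := Finsupp.single a 1)
        rw [add_right_comm, hd', hB, map_add, vertexDegree_single, hf, edgeExponent_mk]
        abel
      · rw [hA, map_add, Finsupp.degree_single] at hn
        omega
    rcases eq_or_ne u v with rfl | huv
    · have hA : A ≠ 0 := by rintro rfl; simp at hn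
      obtain ⟨w, hw⟩ := exists_vertexDegree_ne_zero hA
      obtain ⟨-, e, -⟩ := exists_eq_add_single_of_vertexDegree_ne_zero hw
      have hd' := add_right_cancel hd
      have key := extend (u := w) (v := w) (.nil e w) (by rw [hd']) hw
      have := J.add_mem (J.mul_mem_right (monomial A 1) (hJ _ _ _ h)) (J.mul_mem_left Q key)
      convert this using 1
      ring
    · refine extend h hd fun h0 => ?_
      have := DFunLike.congr_fun hd v
      simp [h0, huv] at this

theorem monomial_sub_monomial_mem_of_vertexDegree_eq
    (hJ : ∀ v P Q, IsEvenWalkPair v v P Q → P - Q ∈ J) {A B : G.edgeSet →₀ ℕ}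
    (hd : vertexDegree G A = vertexDegree G B) :
    monomial A (1 : K) - monomial B 1 ∈ J := by
  rcases eq_or_ne A B with rfl | hAB
  · simp
  obtain ⟨⟨z, hz⟩, -⟩ := Finsupp.ne_iff.1 hAB
  induction z with
  | _ i j =>
    simpa using (IsEvenWalkPair.nil (K := K) (⟨s(i, j), hz⟩ : G.edgeSet) i).mul_monomial_sub_mem
      hJ (A := A) (B := B) (by rw [hd])

/-- Replacing each monomial by a chosen one with the same image shows that the kernel is
generated by binomials. -/
theorem mem_of_aeval_edgeMonomial_eq_zero
    (hJ : ∀ v P Q, IsEvenWalkPair v v P Q → P - Q ∈ J) {f : MvPolynomial G.edgeSet K}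
    (hf : aeval (fun e : G.edgeSet => edgeMonomial V K (e : Sym2 V)) f = 0) : f ∈ J := by
  let L : MvPolynomial V K →ₗ[K] MvPolynomial G.edgeSet K :=
    (basisMonomials V K).constr K fun d => monomial (Function.invFun (vertexDegree G) d) 1
  have hL (d : V →₀ ℕ) : L (monomial d 1) = monomial (Function.invFun (vertexDegree G) d) 1 := by
    simpa [L] using (basisMonomials V K).constr_basis K
      (fun d => monomial (Function.invFun (vertexDegree G) d) (1 : K)) d
  have key (g : MvPolynomial G.edgeSet K) :
      g - L (aeval (fun e : G.edgeSet => edgeMonomial V K (e : Sym2 V)) g) ∈ J := by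
    induction g using MvPolynomial.induction_on' with
    | monomial m c =>
      rw [aeval_edgeMonomial_monomial, ← mul_one c, ← smul_eq_mul, ← smul_monomial,
        ← smul_monomial, map_smul, hL, ← smul_sub]
      exact Submodule.smul_of_tower_mem J c (monomial_sub_monomial_mem_of_vertexDegree_eq hJ
        (Function.invFun_eq ⟨m, rfl⟩).symm)
    | add p q hp hq =>
      rw [map_add, map_add, add_sub_add_comm]
      exact J.add_mem hp hq
  have := key f
  rwa [hf, map_zero, sub_zero] at this

end Span

/-- For a finite simple graph `G` and a field `K`, the toric ideal
`I_G` is generated by the binomials `B_w`, where `w` ranges over the even closed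
walks of `G`. -/
theorem toricIdeal_eq_span_walk_binomials
    (V K : Type) [Fintype V] [Field K] (G : SimpleGraph V) :
    toricIdeal V K G = Ideal.span
      {f : MvPolynomial G.edgeSet K |
        ∃ (q : ℕ) (vert : ℕ → V) (e : ℕ → G.edgeSet),
          (∀ j < 2 * q, (e j : Sym2 V) = s(vert j, vert (j + 1))) ∧
          vert (2 * q) = vert 0 ∧
          f = (∏ k ∈ Finset.range q, X (e (2 * k))) -
                ∏ k ∈ Finset.range q, X (e (2 * k + 1))} := by
  refine le_antisymm (fun f hf => ?_) (Ideal.span_le.2 ?_)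
  · refine mem_of_aeval_edgeMonomial_eq_zero ?_ hf
    rintro v P Q ⟨q, vert, e, hw, h0, hq, rfl, rfl⟩
    exact Ideal.subset_span ⟨q, vert, e, hw, hq.trans h0.symm, rfl⟩
  · rintro _ ⟨q, vert, e, hw, hq, rfl⟩
    have h := IsEvenWalkPair.aeval_left_mul_X (K := K) ⟨q, vert, e, hw, rfl, hq, rfl, rfl⟩
    rw [SetLike.mem_coe, toricIdeal, RingHom.mem_ker, map_sub, sub_eq_zero]
    exact mul_right_cancel₀ (X_ne_zero _) h
end

section
/- The set of primitive binomials of a toric ideal is finite: for any vector configuration A = {a_1,…,a_m} ⊆ ℕ^n and field K, there are only finitely many pairs (u, v) ∈ ℕ^m × ℕ^m with u ≠ v such that x^u − x^v is a primitive binomial of the toric ideal I_A ⊆ K[x_1,…,x_m]. -/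
open MvPolynomial

/-- The monomial map `K[x_1,…,x_m] → K[t_1,…,t_n]` of a vector configuration
`A = {a_1,…,a_m} ⊆ ℕ^n`, sending `x_i` to `t^{a_i} = ∏_j t_j^{(a_i)_j}`. -/
noncomputable def monomialMap (n m : ℕ) (K : Type) [Field K] (a : Fin m → Fin n → ℕ) :
    MvPolynomial (Fin m) K →ₐ[K] MvPolynomial (Fin n) K :=
  aeval fun i => ∏ j, X j ^ a i j

theorem prod_X_pow_eq_monomial_equivFunOnFinite {σ R : Type*} [Fintype σ] [CommSemiring R]
    (u : σ → ℕ) :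
    (∏ i, X i ^ u i : MvPolynomial σ R) = monomial (Finsupp.equivFunOnFinite.symm u) 1 := by
  rw [monomial_eq, Finsupp.prod_fintype _ _ fun i => pow_zero _]
  simp

/-- Comparable pairs with the same nonzero difference of monomials are equal. -/
theorem eq_of_le_of_prod_X_pow_sub_eq {σ R : Type*} [Fintype σ] [CommRing R] [Nontrivial R]
    {p q : (σ → ℕ) × (σ → ℕ)} (hp : p.1 ≠ p.2) (hle : p ≤ q)
    (h : ((∏ i, X i ^ p.1 i) - ∏ i, X i ^ p.2 i : MvPolynomial σ R) =
      (∏ i, X i ^ q.1 i) - ∏ i, X i ^ q.2 i) : p = q := by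
  classical
  simp only [prod_X_pow_eq_monomial_equivFunOnFinite] at h
  have hcoeff (r : σ → ℕ) : ((if p.1 = r then 1 else 0) - (if p.2 = r then 1 else 0) : R) =
      (if q.1 = r then 1 else 0) - (if q.2 = r then 1 else 0) := by
    simpa [coeff_sub, coeff_monomial] using congrArg (coeff (Finsupp.equivFunOnFinite.symm r)) h
  have h₁ := hcoeff p.1
  have h₂ := hcoeff p.2
  rw [if_pos rfl, if_neg hp.symm] at h₁
  rw [if_pos rfl, if_neg hp] at h₂
  by_cases e₁ : q.1 = p.1
  · rw [e₁, if_neg hp] at h₂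
    by_cases e₂ : q.2 = p.2
    · exact Prod.ext e₁.symm e₂.symm
    · simp [e₂] at h₂
  · rw [if_neg e₁] at h₁
    have e₂ : q.2 = p.1 := by
      by_contra e₂
      simp [e₂] at h₁
    rw [e₂, if_neg hp] at h₂
    have e₃ : q.1 = p.2 := by
      by_contra e₃
      simp [e₃] at h₂
    exact absurd (le_antisymm (hle.1.trans_eq e₃) (hle.2.trans_eq e₂)) hp

/-- The set of primitive binomials of a toric ideal is finite: for any
vector configuration `A = {a_1,…,a_m} ⊆ ℕ^n` and field `K`, there are only finitely many
pairs `(u, v) ∈ ℕ^m × ℕ^m` with `u ≠ v` such that `x^u − x^v` is a primitive binomial of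
the toric ideal `I_A = ker(monomialMap)`, i.e. `x^u − x^v ∈ I_A` and no other binomial
`x^w − x^z` in `I_A` satisfies `x^w ∣ x^u` and `x^z ∣ x^v`. -/
theorem primitive_binomials_finite
    (n m : ℕ) (K : Type) [Field K] (a : Fin m → Fin n → ℕ) :
    {p : (Fin m → ℕ) × (Fin m → ℕ) |
      p.1 ≠ p.2 ∧
      ((∏ i, X i ^ p.1 i) - ∏ i, X i ^ p.2 i : MvPolynomial (Fin m) K)
        ∈ RingHom.ker (monomialMap n m K a) ∧
      ∀ w z : Fin m → ℕ, w ≠ z →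
        ((∏ i, X i ^ w i) - ∏ i, X i ^ z i : MvPolynomial (Fin m) K)
          ∈ RingHom.ker (monomialMap n m K a) →
        ((∏ i, X i ^ w i : MvPolynomial (Fin m) K) ∣ ∏ i, X i ^ p.1 i) →
        ((∏ i, X i ^ z i : MvPolynomial (Fin m) K) ∣ ∏ i, X i ^ p.2 i) →
        ((∏ i, X i ^ w i) - ∏ i, X i ^ z i : MvPolynomial (Fin m) K)
          = (∏ i, X i ^ p.1 i) - ∏ i, X i ^ p.2 i}.Finite := by
  refine WellQuasiOrderedLE.finite_of_isAntichain fun p hp q hq hne hle => hne ?_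
  refine eq_of_le_of_prod_X_pow_sub_eq hp.1 hle (hq.2.2 p.1 p.2 hp.1 hp.2.1 ?_ ?_)
  · exact Finset.prod_dvd_prod_of_dvd _ _ fun i _ => pow_dvd_pow _ (hle.1 i)
  · exact Finset.prod_dvd_prod_of_dvd _ _ fun i _ => pow_dvd_pow _ (hle.2 i)
end

section
/- If c = (e_{i_1}, e_{i_2}, …, e_{i_{2q}}) is an even cycle in a finite simple graph G (a closed walk of even length 2q whose vertices are pairwise distinct), then the binomial B_c = ∏_{k=1}^{q} e_{i_{2k-1}} − ∏_{k=1}^{q} e_{i_{2k}} is a primitive binomial of the toric ideal I_G, i.e., B_c belongs to the Graver basis of I_G. -/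
open MvPolynomial

/-- A product of variables indexed by `s`, grouped by the variable. -/
lemma prod_X_eq_prod_pow_card {σ R : Type} [Fintype σ] [DecidableEq σ] [CommRing R]
    (s : Finset ℕ) (g : ℕ → σ) :
    (∏ k ∈ s, X (g k) : MvPolynomial σ R) = ∏ a, X a ^ (s.filter fun k => g k = a).card := by
  rw [← Finset.prod_fiberwise' s g (fun a => (X a : MvPolynomial σ R))]
  simp

lemma le_card_of_prod_pow_dvd_prod_X {σ K : Type} [Fintype σ] [DecidableEq σ] [Field K]
    (s : Finset ℕ) (g : ℕ → σ) (w : σ → ℕ)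
    (h : (∏ a, X a ^ w a : MvPolynomial σ K) ∣ ∏ k ∈ s, X (g k)) (a : σ) :
    w a ≤ (s.filter fun k => g k = a).card := by
  rw [prod_X_eq_prod_pow_card] at h
  have h' := map_dvd (aeval (R := K) fun b => if b = a then (Polynomial.X : Polynomial K) else 1) h
  simp only [map_prod, map_pow, aeval_X, ite_pow, one_pow, Finset.prod_ite_eq',
    Finset.mem_univ, if_true] at h'
  exact (pow_dvd_pow_iff Polynomial.X_ne_zero Polynomial.not_isUnit_X).1 h'

/-- Monomials whose difference lies in the toric ideal have the same degree at each vertex. -/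
lemma sum_incident_eq_of_sub_mem_toricIdeal {V K : Type} [DecidableEq V] [Field K]
    {G : SimpleGraph V} [Fintype G.edgeSet] {w z : G.edgeSet → ℕ}
    (h : ((∏ ed, X ed ^ w ed) - ∏ ed, X ed ^ z ed : MvPolynomial G.edgeSet K)
      ∈ toricIdeal V K G) (v : V) :
    (∑ ed : G.edgeSet, if v ∈ (ed : Sym2 V) then w ed else 0) =
      ∑ ed : G.edgeSet, if v ∈ (ed : Sym2 V) then z ed else 0 := by
  have hev : ∀ ed : G.edgeSet,
      aeval (R := K) (fun u => if u = v then (Polynomial.X : Polynomial K) else 1)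
        (edgeMonomial V K (ed : Sym2 V)) =
      Polynomial.X ^ (if v ∈ (ed : Sym2 V) then 1 else 0) := by
    rintro ⟨ed, hed⟩
    induction ed using Sym2.ind with
    | _ i j =>
      have hij : i ≠ j := G.ne_of_adj hed
      simp only [edgeMonomial, Sym2.lift_mk, map_mul, aeval_X, Sym2.mem_iff]
      by_cases hi : i = v
      · subst hi
        simp [hij.symm]
      · by_cases hj : j = v
        · subst hj
          simp [hij]
        · simp [hi, hj, Ne.symm hi, Ne.symm hj]
  rw [toricIdeal, RingHom.mem_ker, map_sub, sub_eq_zero] at h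
  have h' := congrArg
    (aeval (R := K) fun u => if u = v then (Polynomial.X : Polynomial K) else 1) h
  simp only [map_prod, map_pow, aeval_X, hev, ← pow_mul,
    Finset.prod_pow_eq_pow_sum, ite_mul, one_mul, zero_mul] at h'
  simpa using congrArg Polynomial.natDegree h'

section EvenCycle

variable {V : Type} {G : SimpleGraph V} {q : ℕ} {vert : ℕ → V} {e : ℕ → G.edgeSet}

lemma mem_cycle_edge_iff
    (he : ∀ j < 2 * q, (e j : Sym2 V) = s(vert j, vert (j + 1)))
    (hclosed : vert (2 * q) = vert 0)
    (hdistinct : ∀ j k, j < 2 * q → k < 2 * q → vert j = vert k → j = k)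
    {m j : ℕ} (hm : 0 < m) (hmq : m < 2 * q) (hj : j < 2 * q) :
    vert m ∈ (e j : Sym2 V) ↔ m = j ∨ m = j + 1 := by
  rw [he j hj, Sym2.mem_iff]
  refine or_congr ⟨hdistinct _ _ hmq hj, fun h => h ▸ rfl⟩ ⟨fun h => ?_, fun h => h ▸ rfl⟩
  rcases Nat.lt_or_ge (j + 1) (2 * q) with hlt | hge
  · exact hdistinct _ _ hmq hlt h
  · have hjq : j + 1 = 2 * q := by omega
    rw [hjq, hclosed] at h
    exact absurd (hdistinct _ _ hmq (by omega) h) hm.ne'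

lemma cycle_edge_injOn (hq : 2 ≤ q)
    (he : ∀ j < 2 * q, (e j : Sym2 V) = s(vert j, vert (j + 1)))
    (hclosed : vert (2 * q) = vert 0)
    (hdistinct : ∀ j k, j < 2 * q → k < 2 * q → vert j = vert k → j = k)
    {j k : ℕ} (hj : j < 2 * q) (hk : k < 2 * q) (h : e j = e k) : j = k := by
  have key : ∀ m, 0 < m → m < 2 * q → ((m = j ∨ m = j + 1) ↔ (m = k ∨ m = k + 1)) := by
    intro m hm hmq
    rw [← mem_cycle_edge_iff he hclosed hdistinct hm hmq hj,
      ← mem_cycle_edge_iff he hclosed hdistinct hm hmq hk, h]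
  have h1 := key j
  have h2 := key k
  have h3 := key (j + 1)
  have h4 := key (k + 1)
  omega

/-- If `f` vanishes off the edges of a cycle in some parity class, its degree at a vertex is
its value at the only edge of that class through the vertex. -/
lemma sum_incident_eq_single [DecidableEq V] [Fintype G.edgeSet]
    (he : ∀ j < 2 * q, (e j : Sym2 V) = s(vert j, vert (j + 1)))
    (hclosed : vert (2 * q) = vert 0)
    (hdistinct : ∀ j k, j < 2 * q → k < 2 * q → vert j = vert k → j = k)
    {f : G.edgeSet → ℕ} {r : ℕ} (hr : r < 2)
    (hf : ∀ ed, f ed ≠ 0 → ∃ k < q, e (2 * k + r) = ed)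
    {m k : ℕ} (hm : 0 < m) (hmq : m < 2 * q) (hk : k < q)
    (hmk : m = 2 * k + r ∨ m = 2 * k + r + 1) :
    (∑ ed : G.edgeSet, if vert m ∈ (ed : Sym2 V) then f ed else 0) = f (e (2 * k + r)) := by
  rw [Finset.sum_eq_single (e (2 * k + r))]
  · rw [if_pos ((mem_cycle_edge_iff he hclosed hdistinct hm hmq (by omega)).2 hmk)]
  · intro ed _ hne
    rw [ite_eq_right_iff]
    intro hmem
    by_contra h0
    obtain ⟨l, hl, rfl⟩ := hf ed h0
    rw [mem_cycle_edge_iff he hclosed hdistinct hm hmq (by omega)] at hmem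
    have : l = k := by omega
    exact hne (this ▸ rfl)
  · simp

lemma card_filter_cycle_edge [DecidableEq G.edgeSet] (hq : 2 ≤ q)
    (he : ∀ j < 2 * q, (e j : Sym2 V) = s(vert j, vert (j + 1)))
    (hclosed : vert (2 * q) = vert 0)
    (hdistinct : ∀ j k, j < 2 * q → k < 2 * q → vert j = vert k → j = k)
    {r k : ℕ} (hr : r < 2) (hk : k < q) :
    ((Finset.range q).filter fun l => e (2 * l + r) = e (2 * k + r)).card = 1 := by
  rw [Finset.card_eq_one]
  refine ⟨k, Finset.ext fun l => ?_⟩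
  rw [Finset.mem_filter, Finset.mem_range, Finset.mem_singleton]
  refine ⟨fun ⟨hl, h⟩ => ?_, fun h => ⟨h ▸ hk, by rw [h]⟩⟩
  have := cycle_edge_injOn hq he hclosed hdistinct (by omega) (by omega) h
  omega

end EvenCycle

/-- If `c = (e_0, …, e_{2q-1})` is an even cycle in a finite simple
graph `G` — a closed walk of even length `2q` whose vertices are pairwise distinct
(a cycle has at least `3` edges, so an even cycle has `2q ≥ 4`, i.e. `2 ≤ q`) —
then the binomial `B_c = ∏_{k<q} e_{2k} − ∏_{k<q} e_{2k+1}` is a primitive binomial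
of the toric ideal `I_G`: the two monomials are distinct, `B_c ∈ I_G`, and no other
binomial `e^w − e^z` in `I_G` satisfies `e^w ∣ E⁺(c)` and `e^z ∣ E⁻(c)`;
i.e. `B_c` belongs to the Graver basis of `I_G`. -/
theorem even_cycle_binomial_primitive
    (V K : Type) [Fintype V] [DecidableEq V] [Field K]
    (G : SimpleGraph V) [DecidableRel G.Adj]
    (q : ℕ) (hq : 2 ≤ q) (vert : ℕ → V) (e : ℕ → G.edgeSet)
    (he : ∀ j < 2 * q, (e j : Sym2 V) = s(vert j, vert (j + 1)))
    (hclosed : vert (2 * q) = vert 0)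
    (hdistinct : ∀ j k, j < 2 * q → k < 2 * q → vert j = vert k → j = k) :
    ((∏ k ∈ Finset.range q, X (e (2 * k))) : MvPolynomial G.edgeSet K)
        ≠ ∏ k ∈ Finset.range q, X (e (2 * k + 1)) ∧
    ((∏ k ∈ Finset.range q, X (e (2 * k))) -
        ∏ k ∈ Finset.range q, X (e (2 * k + 1)) : MvPolynomial G.edgeSet K)
      ∈ toricIdeal V K G ∧
    ∀ w z : G.edgeSet → ℕ, w ≠ z →
      ((∏ ed, X ed ^ w ed) - ∏ ed, X ed ^ z ed : MvPolynomial G.edgeSet K)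
        ∈ toricIdeal V K G →
      ((∏ ed, X ed ^ w ed : MvPolynomial G.edgeSet K)
        ∣ ∏ k ∈ Finset.range q, X (e (2 * k))) →
      ((∏ ed, X ed ^ z ed : MvPolynomial G.edgeSet K)
        ∣ ∏ k ∈ Finset.range q, X (e (2 * k + 1))) →
      ((∏ ed, X ed ^ w ed) - ∏ ed, X ed ^ z ed : MvPolynomial G.edgeSet K)
        = (∏ k ∈ Finset.range q, X (e (2 * k))) -
            ∏ k ∈ Finset.range q, X (e (2 * k + 1)) := by
  classical
  have hinj := fun {j k : ℕ} => cycle_edge_injOn (j := j) (k := k) hq he hclosed hdistinct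
  refine ⟨fun h => ?_, ?_, fun w z hwz hmem hw hz => ?_⟩
  · have h' := congrArg (aeval (R := K) fun ed => if ed = e 0 then (0 : K) else 1) h
    simp only [map_prod, aeval_X] at h'
    rw [Finset.prod_eq_zero (i := 0) (Finset.mem_range.2 (by omega)) (by simp),
      Finset.prod_eq_one] at h'
    · exact zero_ne_one h'
    · intro k hk
      rw [Finset.mem_range] at hk
      refine if_neg fun h0 => ?_
      have := hinj (by omega) (by omega) h0
      omega
  · rw [toricIdeal, RingHom.mem_ker, map_sub, sub_eq_zero]
    simp only [map_prod, aeval_X]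
    have hl : ∏ k ∈ Finset.range q, edgeMonomial V K (e (2 * k) : Sym2 V) =
        ∏ k ∈ Finset.range q, (X (vert (2 * k)) * X (vert (2 * k + 1))) :=
      Finset.prod_congr rfl fun k hk => by
        rw [he _ (by have := Finset.mem_range.1 hk; omega)]
        rfl
    have hr : ∏ k ∈ Finset.range q, edgeMonomial V K (e (2 * k + 1) : Sym2 V) =
        ∏ k ∈ Finset.range q, (X (vert (2 * k + 1)) * X (vert (2 * (k + 1)))) :=
      Finset.prod_congr rfl fun k hk => by
        rw [he _ (by have := Finset.mem_range.1 hk; omega)]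
        rfl
    have hshift : ∏ k ∈ Finset.range q, (X (vert (2 * (k + 1))) : MvPolynomial V K) =
        ∏ k ∈ Finset.range q, X (vert (2 * k)) := by
      obtain ⟨p, rfl⟩ : ∃ p, q = p + 1 := ⟨q - 1, by omega⟩
      rw [Finset.prod_range_succ, Finset.prod_range_succ' _ p, hclosed]
    rw [hl, hr, Finset.prod_mul_distrib, Finset.prod_mul_distrib, hshift, mul_comm]
  · have hw' := le_card_of_prod_pow_dvd_prod_X _ (fun k => e (2 * k + 0)) w hw
    have hz' := le_card_of_prod_pow_dvd_prod_X _ (fun k => e (2 * k + 1)) z hz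
    have hsupp : ∀ (f : G.edgeSet → ℕ) (r : ℕ),
        (∀ ed, f ed ≤ ((Finset.range q).filter fun k => e (2 * k + r) = ed).card) →
        ∀ ed, f ed ≠ 0 → ∃ k < q, e (2 * k + r) = ed := by
      intro f r hf ed hed
      obtain ⟨k, hk⟩ := Finset.card_pos.1 ((Nat.pos_of_ne_zero hed).trans_le (hf ed))
      rw [Finset.mem_filter, Finset.mem_range] at hk
      exact ⟨k, hk⟩
    have hws := hsupp w 0 hw'
    have hzs := hsupp z 1 hz'
    have hdeg := sum_incident_eq_of_sub_mem_toricIdeal hmem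
    have hodd : ∀ k < q, w (e (2 * k + 0)) = z (e (2 * k + 1)) := by
      intro k hk
      have h := hdeg (vert (2 * k + 1))
      rwa [sum_incident_eq_single he hclosed hdistinct (by omega) hws (k := k)
          (by omega) (by omega) hk (by omega),
        sum_incident_eq_single he hclosed hdistinct (by omega) hzs (k := k)
          (by omega) (by omega) hk (by omega)] at h
    have heven : ∀ k, k + 1 < q → w (e (2 * (k + 1) + 0)) = z (e (2 * k + 1)) := by
      intro k hk
      have h := hdeg (vert (2 * (k + 1)))
      rwa [sum_incident_eq_single he hclosed hdistinct (by omega) hws (k := k + 1)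
          (by omega) (by omega) hk (by omega),
        sum_incident_eq_single he hclosed hdistinct (by omega) hzs (k := k)
          (by omega) (by omega) (by omega) (by omega)] at h
    have hwc : ∀ k < q, w (e (2 * k + 0)) = w (e 0) := by
      intro k
      induction k with
      | zero => intro _; rfl
      | succ k ih =>
        intro hk
        rw [heven k hk, ← hodd k (by omega), ih (by omega)]
    have hzc : ∀ k < q, z (e (2 * k + 1)) = w (e 0) := fun k hk =>
      (hodd k hk).symm.trans (hwc k hk)
    have hcard := fun {r k : ℕ} =>
      card_filter_cycle_edge (r := r) (k := k) hq he hclosed hdistinct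
    have hc0 : w (e 0) ≠ 0 := by
      intro h0
      apply hwz
      have hw0 : w = 0 := funext fun ed => by
        by_contra hne
        obtain ⟨k, hk, rfl⟩ := hws ed hne
        exact hne ((hwc k hk).trans h0)
      have hz0 : z = 0 := funext fun ed => by
        by_contra hne
        obtain ⟨k, hk, rfl⟩ := hzs ed hne
        exact hne ((hzc k hk).trans h0)
      rw [hw0, hz0]
    have hc1 : w (e 0) = 1 :=
      le_antisymm ((hw' (e 0)).trans_eq (hcard (r := 0) (k := 0) (by omega) (by omega)))
        (Nat.pos_of_ne_zero hc0)
    have heq : ∀ (f : G.edgeSet → ℕ) (r : ℕ), r < 2 →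
        (∀ ed, f ed ≤ ((Finset.range q).filter fun k => e (2 * k + r) = ed).card) →
        (∀ k < q, f (e (2 * k + r)) = 1) →
        (∏ ed, X ed ^ f ed : MvPolynomial G.edgeSet K) =
          ∏ k ∈ Finset.range q, X (e (2 * k + r)) := by
      intro f r hr hf hf1
      rw [prod_X_eq_prod_pow_card]
      refine Finset.prod_congr rfl fun ed _ => ?_
      congr 1
      refine (hf ed).antisymm ?_
      by_cases hex : ∃ k < q, e (2 * k + r) = ed
      · obtain ⟨k, hk, rfl⟩ := hex
        rw [hf1 k hk, hcard hr hk]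
      · rw [Finset.filter_false_of_mem fun k hk h => hex ⟨k, Finset.mem_range.1 hk, h⟩]
        simp
    rw [heq w 0 (by omega) hw' fun k hk => (hwc k hk).trans hc1,
      heq z 1 (by omega) hz' fun k hk => (hzc k hk).trans hc1]
    rfl
end

section
/- Every primitive binomial of the toric ideal of a finite simple graph arises from an even closed walk: if G is a finite simple graph, K a field, and f = e^u − e^v (with u ≠ v) is a primitive binomial of the toric ideal I_G, then there exists an even closed walk w = (e_{i_1},…,e_{i_{2q}}) in G such that f = B_w = ∏_{k=1}^{q} e_{i_{2k-1}} − ∏_{k=1}^{q} e_{i_{2k}}. -/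
open MvPolynomial

namespace SimpleGraph

variable {V : Type} {G : SimpleGraph V}

/-- The degree at the vertex `x` of an edge weighting `w`, which is the exponent of `t_x` in the
image of `e^w` under the monomial map. -/
def weightDegree [DecidableEq V] [Fintype G.edgeSet] (w : G.edgeSet → ℕ) (x : V) : ℕ :=
  ∑ e : G.edgeSet, if x ∈ (e : Sym2 V) then w e else 0

lemma ite_mem_edge [DecidableEq V] {e : Sym2 V} (he : e ∈ G.edgeSet) {a b : V} (h : e = s(a, b)) (x : V) :
    (if x ∈ e then 1 else 0) = (if x = a then 1 else 0) + (if x = b then 1 else 0) := by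
  subst h
  have hab : a ≠ b := G.ne_of_adj he
  by_cases ha : x = a <;> by_cases hb : x = b <;> simp_all

lemma edgeMonomial_eq_prod [DecidableEq V] [Fintype V] (K : Type) [Field K]
    (e : G.edgeSet) :
    edgeMonomial V K e = ∏ x, X x ^ (if x ∈ (e : Sym2 V) then 1 else 0) := by
  obtain ⟨e, he⟩ := e
  induction e using Sym2.ind with
  | _ a b =>
    simp only [ite_mem_edge he rfl, pow_add, Finset.prod_mul_distrib, pow_ite, pow_one, pow_zero,
      Finset.prod_ite_eq', Finset.mem_univ, if_true]
    rfl

lemma prod_X_pow_injective (K : Type) [Field K] {σ : Type} [Fintype σ] :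
    Function.Injective fun n : σ → ℕ => ∏ x, (X x : MvPolynomial σ K) ^ n x := by
  intro n m h
  have key (n : σ → ℕ) : ∏ x, (X x : MvPolynomial σ K) ^ n x =
      monomial (Finsupp.equivFunOnFinite.symm n) 1 := by
    rw [monomial_eq, Finsupp.prod_fintype _ _ (by simp)]
    simp
  simp only [key] at h
  exact Finsupp.equivFunOnFinite.symm.injective (monomial_left_injective one_ne_zero h)

section weightDegree

variable [DecidableEq V] [Fintype G.edgeSet]

lemma weightDegree_add (w z : G.edgeSet → ℕ) (x : V) :
    weightDegree (w + z) x = weightDegree w x + weightDegree z x := by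
  simp only [weightDegree, ← Finset.sum_add_distrib]
  refine Finset.sum_congr rfl fun e _ => ?_
  split_ifs <;> simp

lemma weightDegree_single (g : G.edgeSet) (x : V) :
    weightDegree (Pi.single g 1) x = if x ∈ (g : Sym2 V) then 1 else 0 := by
  rw [weightDegree, Finset.sum_eq_single g]
  · simp
  · intro e _ he
    simp [he]
  · simp

lemma weightDegree_mono {w z : G.edgeSet → ℕ} (h : w ≤ z) (x : V) :
    weightDegree w x ≤ weightDegree z x := by
  refine Finset.sum_le_sum fun e _ => ?_
  split_ifs
  exacts [h e, le_rfl]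

lemma exists_lt_of_weightDegree_lt {w u : G.edgeSet → ℕ} {x : V}
    (h : weightDegree w x < weightDegree u x) :
    ∃ g : G.edgeSet, x ∈ (g : Sym2 V) ∧ w g < u g := by
  obtain ⟨g, -, hg⟩ := Finset.exists_lt_of_sum_lt h
  by_cases hx : x ∈ (g : Sym2 V)
  · exact ⟨g, hx, by simpa [hx] using hg⟩
  · simp [hx] at hg

variable [Fintype V] (K : Type) [Field K]

lemma aeval_edgeMonomial_prod (w : G.edgeSet → ℕ) :
    aeval (fun e : G.edgeSet => edgeMonomial V K (e : Sym2 V))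
        (∏ e, X e ^ w e : MvPolynomial G.edgeSet K) =
      ∏ x, (X x : MvPolynomial V K) ^ weightDegree w x := by
  simp only [map_prod, map_pow, aeval_X, edgeMonomial_eq_prod, weightDegree,
    ← Finset.prod_pow, ← pow_mul]
  rw [Finset.prod_comm]
  refine Finset.prod_congr rfl fun x _ => ?_
  rw [Finset.prod_pow_eq_pow_sum]
  simp

lemma prod_sub_prod_mem_toricIdeal_iff (w z : G.edgeSet → ℕ) :
    ((∏ e, X e ^ w e) - ∏ e, X e ^ z e : MvPolynomial G.edgeSet K) ∈ toricIdeal V K G ↔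
      ∀ x, weightDegree w x = weightDegree z x := by
  rw [toricIdeal, RingHom.mem_ker, map_sub, sub_eq_zero, aeval_edgeMonomial_prod,
    aeval_edgeMonomial_prod, (prod_X_pow_injective K).eq_iff, funext_iff]

end weightDegree

section AlternatingWalk

variable [DecidableEq V]

/-- `AlternatingWalk a q b w z` means that there is a walk of length `2 * q` from `a` to `b` which
passes `w e` times in even position and `z e` times in odd position through each edge `e`,
positions being counted from zero. -/
inductive AlternatingWalk (a : V) : ℕ → V → (G.edgeSet → ℕ) → (G.edgeSet → ℕ) → Prop
  | nil : AlternatingWalk a 0 a 0 0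
  | snoc {q : ℕ} {b c d : V} {w z : G.edgeSet → ℕ} {g h : G.edgeSet}
      (hw : AlternatingWalk a q b w z) (hg : (g : Sym2 V) = s(b, c)) (hh : (h : Sym2 V) = s(c, d)) :
      AlternatingWalk a (q + 1) d (w + Pi.single g 1) (z + Pi.single h 1)

namespace AlternatingWalk

variable [Fintype G.edgeSet] {a b : V} {q : ℕ} {w z : G.edgeSet → ℕ}

lemma weightDegree_add_eq (H : AlternatingWalk a q b w z) (x : V) :
    weightDegree w x + (if x = b then 1 else 0) = weightDegree z x + (if x = a then 1 else 0) := by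
  induction H with
  | nil => rfl
  | @snoc q b c d w z g h hw hg hh ih =>
    rw [weightDegree_add, weightDegree_add, weightDegree_single, weightDegree_single,
      ite_mem_edge g.2 hg, ite_mem_edge h.2 hh]
    omega

lemma sum_eq (H : AlternatingWalk a q b w z) : ∑ e, w e = q := by
  induction H with
  | nil => simp
  | snoc hw hg hh ih => simp [Finset.sum_add_distrib, ih]

lemma exists_sequence {R : Type} [CommRing R] [Nonempty G.edgeSet] (H : AlternatingWalk a q b w z) :
    ∃ (vert : ℕ → V) (e : ℕ → G.edgeSet), vert 0 = a ∧ vert (2 * q) = b ∧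
      (∀ j < 2 * q, (e j : Sym2 V) = s(vert j, vert (j + 1))) ∧
      (∏ ed, X ed ^ w ed : MvPolynomial G.edgeSet R) = ∏ k ∈ Finset.range q, X (e (2 * k)) ∧
      (∏ ed, X ed ^ z ed : MvPolynomial G.edgeSet R) =
        ∏ k ∈ Finset.range q, X (e (2 * k + 1)) := by
  have hsingle (g : G.edgeSet) :
      ∏ ed, (X ed : MvPolynomial G.edgeSet R) ^ (Pi.single g 1 : G.edgeSet → ℕ) ed = X g := by
    rw [Finset.prod_eq_single g] <;> simp +contextual
  induction H with
  | nil =>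
    exact ⟨fun _ => a, fun _ => Classical.arbitrary _, by simp⟩
  | @snoc q b c d w z g h hw hg hh ih =>
    obtain ⟨vert, e, h0, hq, he, h1, h2⟩ := ih
    refine ⟨fun j => if j ≤ 2 * q then vert j else if j = 2 * q + 1 then c else d,
      fun j => if j < 2 * q then e j else if j = 2 * q then g else h, by simp [h0], ?_, ?_, ?_, ?_⟩
    · simp [mul_add]
    · intro j hj
      obtain hj | rfl | rfl : j < 2 * q ∨ j = 2 * q ∨ j = 2 * q + 1 := by omega
      · simp [hj, hj.le, Nat.succ_le_of_lt hj, he]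
      · simp [hq, hg]
      · simp [hh]
    · simp only [Pi.add_apply, pow_add, Finset.prod_mul_distrib, hsingle, h1,
        Finset.prod_range_succ]
      congr 1
      · refine Finset.prod_congr rfl fun k hk => ?_
        rw [if_pos (by have := Finset.mem_range.1 hk; omega)]
      · simp
    · simp only [Pi.add_apply, pow_add, Finset.prod_mul_distrib, hsingle, h2,
        Finset.prod_range_succ]
      congr 1
      · refine Finset.prod_congr rfl fun k hk => ?_
        rw [if_pos (by have := Finset.mem_range.1 hk; omega)]
      · simp

/-- An alternating walk whose edges are taken from a pair of balanced weightings can be prolonged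
within these weightings as long as a further edge for its end vertex is left in the first one. -/
lemma exists_snoc {u v : G.edgeSet → ℕ} (hbal : ∀ x, weightDegree u x = weightDegree v x)
    (H : AlternatingWalk a q b w z) (hw : w ≤ u) (hz : z ≤ v)
    (hlt : weightDegree w b < weightDegree u b) :
    ∃ (d : V) (w' z' : G.edgeSet → ℕ), AlternatingWalk a (q + 1) d w' z' ∧ w' ≤ u ∧ z' ≤ v := by
  have hext {w u : G.edgeSet → ℕ} {g : G.edgeSet} (hw : w ≤ u) (hg : w g < u g) :
      w + Pi.single g 1 ≤ u := by
    intro e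
    by_cases he : e = g
    · subst he
      simpa using hg
    · simpa [he] using hw e
  obtain ⟨g, hbg, hg⟩ := exists_lt_of_weightDegree_lt hlt
  obtain ⟨c, hc⟩ := Sym2.mem_iff_exists.1 hbg
  have hbc : c ≠ b := by
    rintro rfl
    exact G.ne_of_adj (G.mem_edgeSet.1 (hc ▸ g.2)) rfl
  have hw' := hext hw hg
  have hlt' : weightDegree z c < weightDegree v c := by
    have h1 := weightDegree_mono hw' c
    rw [weightDegree_add, weightDegree_single, hc, if_pos (Sym2.mem_mk_right b c)] at h1
    have h2 := H.weightDegree_add_eq c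
    rw [if_neg hbc] at h2
    have h3 := hbal c
    omega
  obtain ⟨h, hch, hh⟩ := exists_lt_of_weightDegree_lt hlt'
  obtain ⟨d, hd⟩ := Sym2.mem_iff_exists.1 hch
  exact ⟨d, _, _, H.snoc hc hd, hw', hext hz hh⟩

end AlternatingWalk

lemma exists_closed_alternatingWalk [Fintype G.edgeSet] {u v : G.edgeSet → ℕ}
    (hbal : ∀ x, weightDegree u x = weightDegree v x) (hu : u ≠ 0) :
    ∃ (a : V) (q : ℕ) (w z : G.edgeSet → ℕ),
      AlternatingWalk a q a w z ∧ 0 < q ∧ w ≤ u ∧ z ≤ v := by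
  by_contra! hno
  obtain ⟨⟨e, he⟩, hue⟩ := Function.ne_iff.1 hu
  induction e using Sym2.ind with
  | _ a a' =>
  have hlong (q : ℕ) : ∃ (b : V) (w z : G.edgeSet → ℕ),
      AlternatingWalk a q b w z ∧ w ≤ u ∧ z ≤ v := by
    induction q with
    | zero => exact ⟨a, 0, 0, .nil, fun _ => Nat.zero_le _, fun _ => Nat.zero_le _⟩
    | succ q ih =>
      obtain ⟨b, w, z, H, hw, hz⟩ := ih
      refine H.exists_snoc hbal hw hz ?_
      rcases Nat.eq_zero_or_pos q with rfl | hq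
      · cases H
        have h1 : weightDegree (Pi.single ⟨s(a, a'), he⟩ 1) a ≤ weightDegree u a := by
          refine weightDegree_mono (fun e => ?_) a
          by_cases h : e = ⟨s(a, a'), he⟩
          · subst h
            simpa using Nat.one_le_iff_ne_zero.2 hue
          · simp [h]
        rw [weightDegree_single, if_pos (Sym2.mem_mk_left a a')] at h1
        have h0 : weightDegree (0 : G.edgeSet → ℕ) a = 0 := by simp [weightDegree]
        omega
      · have hba : b ≠ a := by
          rintro rfl
          exact hno b q w z H hq hw hz
        have h1 := H.weightDegree_add_eq b
        rw [if_pos rfl, if_neg hba] at h1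
        have h2 := weightDegree_mono hz b
        have h3 := hbal b
        omega
  obtain ⟨b, w, z, H, hw, -⟩ := hlong (∑ e, u e + 1)
  have h1 := H.sum_eq
  have h2 : ∑ e, w e ≤ ∑ e, u e := Finset.sum_le_sum fun e _ => hw e
  omega

end AlternatingWalk

end SimpleGraph

open SimpleGraph in
/-- Every primitive binomial of the toric ideal of a finite simple
graph arises from an even closed walk: if `f = e^u − e^v` (with `u ≠ v`) lies in `I_G`
and no other binomial `e^w − e^z` in `I_G` satisfies `e^w ∣ e^u` and `e^z ∣ e^v`,
then there is an even closed walk `w = (e_0, …, e_{2q-1})` in `G` with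
`f = B_w = ∏_{k<q} e_{2k} − ∏_{k<q} e_{2k+1}`. -/
theorem primitive_binomial_eq_walk_binomial
    (V K : Type) [Fintype V] [DecidableEq V] [Field K]
    (G : SimpleGraph V) [DecidableRel G.Adj]
    (u v : G.edgeSet → ℕ) (huv : u ≠ v)
    (hmem : ((∏ e, X e ^ u e) - ∏ e, X e ^ v e : MvPolynomial G.edgeSet K)
      ∈ toricIdeal V K G)
    (hprim : ∀ w z : G.edgeSet → ℕ, w ≠ z →
      ((∏ e, X e ^ w e) - ∏ e, X e ^ z e : MvPolynomial G.edgeSet K) ∈ toricIdeal V K G →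
      ((∏ e, X e ^ w e : MvPolynomial G.edgeSet K) ∣ ∏ e, X e ^ u e) →
      ((∏ e, X e ^ z e : MvPolynomial G.edgeSet K) ∣ ∏ e, X e ^ v e) →
      ((∏ e, X e ^ w e) - ∏ e, X e ^ z e : MvPolynomial G.edgeSet K)
        = (∏ e, X e ^ u e) - ∏ e, X e ^ v e) :
    ∃ (q : ℕ) (vert : ℕ → V) (e : ℕ → G.edgeSet),
      (∀ j < 2 * q, (e j : Sym2 V) = s(vert j, vert (j + 1))) ∧
      vert (2 * q) = vert 0 ∧
      ((∏ ed, X ed ^ u ed) - ∏ ed, X ed ^ v ed : MvPolynomial G.edgeSet K)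
        = (∏ k ∈ Finset.range q, X (e (2 * k))) -
            ∏ k ∈ Finset.range q, X (e (2 * k + 1)) := by
  rw [prod_sub_prod_mem_toricIdeal_iff] at hmem
  have hsplit (s t : G.edgeSet → ℕ) : (s - s ⊓ t) + s ⊓ t = s := by
    funext e
    simp
  have hbal (x : V) : weightDegree (u - u ⊓ v) x = weightDegree (v - v ⊓ u) x := by
    have h1 := weightDegree_add (u - u ⊓ v) (u ⊓ v) x
    have h2 := weightDegree_add (v - v ⊓ u) (v ⊓ u) x
    rw [hsplit] at h1 h2
    rw [inf_comm v u] at h2 ⊢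
    have h3 := hmem x
    omega
  -- If `u ≤ v`, then equality of the degrees at an end of each edge forces `u = v`.
  have hne : u - u ⊓ v ≠ 0 := by
    intro h0
    have huv' : u ≤ v := fun e => tsub_eq_zero_iff_le.1 (congrFun h0 e) |>.trans inf_le_right
    refine huv (funext fun e => (huv' e).antisymm ?_)
    by_contra! hlt
    obtain ⟨x, hx⟩ : ∃ x, x ∈ (e : Sym2 V) := ⟨_, Sym2.out_fst_mem _⟩
    refine (hmem x).not_lt (Finset.sum_lt_sum (fun i _ => ?_) ⟨e, Finset.mem_univ e, ?_⟩)
    · split_ifs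
      exacts [huv' i, le_rfl]
    · simpa [hx] using hlt
  obtain ⟨a, q, w, z, H, hq, hw, hz⟩ := exists_closed_alternatingWalk hbal hne
  have : Nonempty G.edgeSet := (Function.ne_iff.1 huv).nonempty
  obtain ⟨vert, e, h0, h2q, he, h1, h2⟩ := H.exists_sequence (R := K)
  have hdvd {s t : G.edgeSet → ℕ} (h : s ≤ t) :
      (∏ e, X e ^ s e : MvPolynomial G.edgeSet K) ∣ ∏ e, X e ^ t e :=
    Finset.prod_dvd_prod_of_dvd _ _ fun e _ => pow_dvd_pow _ (h e)
  refine ⟨q, vert, e, he, h2q.trans h0.symm, ?_⟩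
  rw [← h1, ← h2]
  refine (hprim w z ?_ ?_ (hdvd (hw.trans tsub_le_self)) (hdvd (hz.trans tsub_le_self))).symm
  · rintro rfl
    have hzero (e : G.edgeSet) : w e = 0 := by
      have h1 := hw e
      have h2 := hz e
      simp only [Pi.sub_apply, Pi.inf_apply] at h1 h2
      omega
    have := H.sum_eq
    simp [hzero] at this
    omega
  · rw [prod_sub_prod_mem_toricIdeal_iff]
    exact fun x => by simpa using H.weightDegree_add_eq x
end
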